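/- arXiv:1901.02128 — 7 statements merged into one kernel-verified Lean document; each statement's English description precedes it below -/
import Mathlib

section
/- Let w > 0 and let k ≥ 2 be an integer such that r_{k−1} ≥ w², |θ̃_{k−1}| ≤ 1, and |y_{k−1}| ≤ w/(2√(k−1)). If the noise sequence satisfies w_t = −θ̃_{t−1}·y_{t−1} + S(y_{t−1})·w/(2√t) for all t ≥ k, then |w_t| ≤ w for all t ≥ k. -/
open Filter Finset

/-- The sign function: `-1` if `x < 0`, `1` if `x ≥ 0`. -/
noncomputable def S (x : ℝ) : ℝ := if x < 0 then -1 else 1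

theorem abs_S (x : ℝ) : |S x| = 1 := by
  unfold S
  split_ifs <;> simp

/-- `1 / (4 √t √(t+1)) ≤ 2√(t+1) - 2√t`, in terms of the two square roots. -/
theorem inv_four_mul_le_two_mul_sub {a b : ℝ} (ha : 1 ≤ a) (hab : a ≤ b)
    (h : b ^ 2 = a ^ 2 + 1) : 1 / (4 * a * b) ≤ 2 * b - 2 * a := by
  have hb : 0 < b := by linarith
  have h₁ : b - a = 1 / (a + b) := by
    rw [eq_div_iff (by positivity)]
    linarith [show (b - a) * (a + b) = b ^ 2 - a ^ 2 by ring]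
  have h₂ : 1 / (4 * a * b) ≤ 1 / (a + b) :=
    one_div_le_one_div_of_le (by positivity) (by nlinarith [mul_le_mul_of_nonneg_right ha hb.le])
  have h₃ : 0 ≤ 1 / (a + b) := by positivity
  linarith

/-- The correction of the parameter estimate is small when the outputs are. -/
theorem abs_mul_div_le {w a b u v ρ : ℝ} (hw : 0 < w) (ha : 0 < a) (hb : 0 < b)
    (hu : |u| ≤ w / (2 * a)) (hv : |v| ≤ w / (2 * b)) (hρ : w ^ 2 ≤ ρ) :
    |u * v / ρ| ≤ 1 / (4 * a * b) := by
  have hρ' : 0 < ρ := lt_of_lt_of_le (by positivity) hρ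
  rw [abs_div, abs_mul, abs_of_pos hρ']
  calc |u| * |v| / ρ ≤ (w / (2 * a)) * (w / (2 * b)) / w ^ 2 := by gcongr
    _ = 1 / (4 * a * b) := by field_simp; norm_num

/-- Lemma 1: under the closed-loop LS dynamics, if at some time `k ≥ 2`
we have `r (k-1) ≥ w²`, `|θ̃ (k-1)| ≤ 1`, `|y (k-1)| ≤ w / (2√(k-1))`, and the noise is
chosen as `w_t = -θ̃_{t-1} y_{t-1} + S(y_{t-1}) w / (2√t)` for `t ≥ k`, then `|w_t| ≤ w`
for all `t ≥ k`. -/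
theorem noise_bounded
    (y θ r W : ℕ → ℝ) (hr0 : 0 < r 0)
    (hy : ∀ t : ℕ, y (t + 1) = θ t * y t + W (t + 1))
    (hθ : ∀ t : ℕ, θ (t + 1) = θ t - y t * y (t + 1) / r t)
    (hr : ∀ t : ℕ, r (t + 1) = r t + (y (t + 1)) ^ 2)
    (w : ℝ) (hw : 0 < w) (k : ℕ) (hk : 2 ≤ k)
    (hrk : w ^ 2 ≤ r (k - 1))
    (hθk : |θ (k - 1)| ≤ 1)
    (hyk : |y (k - 1)| ≤ w / (2 * Real.sqrt (k - 1 : ℕ)))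
    (hW : ∀ t : ℕ, k ≤ t →
      W t = -θ (t - 1) * y (t - 1) + S (y (t - 1)) * w / (2 * Real.sqrt t)) :
    ∀ t : ℕ, k ≤ t → |W t| ≤ w := by
  obtain ⟨m, rfl⟩ : ∃ m, k = m + 1 := ⟨k - 1, by omega⟩
  simp only [Nat.add_sub_cancel] at hrk hθk hyk
  have one_le_sqrt : ∀ t : ℕ, m ≤ t → 1 ≤ √(t : ℝ) := fun t ht =>
    Real.one_le_sqrt.mpr (by exact_mod_cast (show 1 ≤ t by omega))
  have hW' : ∀ t : ℕ, m ≤ t →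
      W (t + 1) = -θ t * y t + S (y t) * w / (2 * √((t + 1 : ℕ) : ℝ)) := fun t ht => by
    simpa only [Nat.add_sub_cancel] using hW (t + 1) (by omega)
  have abs_term : ∀ t : ℕ, |S (y t) * w / (2 * √((t + 1 : ℕ) : ℝ))| =
      w / (2 * √((t + 1 : ℕ) : ℝ)) := fun t => by
    rw [abs_div, abs_mul, abs_S, one_mul, abs_of_pos hw, abs_of_nonneg (by positivity)]
  have key : ∀ t : ℕ, m ≤ t →
      w ^ 2 ≤ r t ∧ |θ t| ≤ 2 * √(t : ℝ) - 1 ∧ |y t| ≤ w / (2 * √(t : ℝ)) := by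
    intro t ht
    induction t, ht using Nat.le_induction with
    | base => exact ⟨hrk, by linarith [one_le_sqrt m le_rfl], hyk⟩
    | succ t ht ih =>
      obtain ⟨ihr, ihθ, ihy⟩ := ih
      have hy' : |y (t + 1)| ≤ w / (2 * √((t + 1 : ℕ) : ℝ)) := by
        rw [hy, hW' t ht, ← abs_term t]
        exact le_of_eq (by congr 1; ring)
      have ha := one_le_sqrt t ht
      have hb := one_le_sqrt (t + 1) (by omega)
      refine ⟨by rw [hr]; nlinarith [sq_nonneg (y (t + 1))], ?_, hy'⟩
      have hstep := abs_mul_div_le hw (by linarith) (by linarith) ihy hy' ihr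
      have hinc := inv_four_mul_le_two_mul_sub ha
        (Real.sqrt_le_sqrt (by push_cast; linarith) : √(t : ℝ) ≤ √((t + 1 : ℕ) : ℝ))
        (by rw [Real.sq_sqrt (by positivity), Real.sq_sqrt (by positivity)]; push_cast; ring)
      rw [hθ]
      linarith [abs_sub (θ t) (y t * y (t + 1) / r t)]
  intro t ht
  obtain ⟨t, rfl⟩ : ∃ s, t = s + 1 := ⟨t - 1, by omega⟩
  have ht' : m ≤ t := by omega
  obtain ⟨-, hθt, hyt⟩ := key t ht'
  have ha := one_le_sqrt t ht'
  have hle : √(t : ℝ) ≤ √((t + 1 : ℕ) : ℝ) := Real.sqrt_le_sqrt (by push_cast; linarith)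
  calc |W (t + 1)| ≤ |-θ t * y t| + |S (y t) * w / (2 * √((t + 1 : ℕ) : ℝ))| := by
        rw [hW' t ht']; exact abs_add_le _ _
    _ = |θ t| * |y t| + w / (2 * √((t + 1 : ℕ) : ℝ)) := by rw [abs_term, abs_mul, abs_neg]
    _ ≤ (2 * √(t : ℝ) - 1) * (w / (2 * √(t : ℝ))) + w / (2 * √(t : ℝ)) := by
        gcongr
        linarith
    _ = w := by field_simp; ring
end

section
/- Let w > 0 and let k ≥ 2 be an integer such that r_{k−1} ≥ w², |θ̃_{k−1}| ≤ 1, and |y_{k−1}| ≤ w/(2√(k−1)). If w_t = −θ̃_{t−1}·y_{t−1} + S(y_{t−1})·w/(2√t) for all t ≥ k, then the sequence (θ̃_t)_{t≥k+1} is non-increasing and θ̃_t → −∞ as t → ∞. -/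
open Filter Finset

lemma S_mul_self (x : ℝ) : S x * S x = 1 := by
  unfold S; split_ifs <;> norm_num

lemma S_S_mul (x : ℝ) {c : ℝ} (hc : 0 < c) : S (S x * c) = S x := by
  unfold S
  by_cases hx : x < 0
  · simp [hx, hc]
  · simp [hx, hc.le]

/-- If the increments of `r` are eventually `c / (t + 1)` with `c > 0`, then `r → ∞`. -/
lemma tendsto_atTop_of_harmonic_increments {r : ℕ → ℝ} {c : ℝ} (hc : 0 < c) {k : ℕ}
    (h : ∀ t, k ≤ t → r (t + 1) = r t + c / (t + 1)) : Tendsto r atTop atTop := by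
  set H : ℕ → ℝ := fun n => ∑ i ∈ range n, (1 : ℝ) / (i + 1) with hH
  have hconst : ∀ t, k ≤ t → r t = c * H t + (r k - c * H k) := by
    intro t ht
    induction t, ht using Nat.le_induction with
    | base => ring
    | succ t ht ih =>
      have hs : H (t + 1) = H t + 1 / (t + 1) := sum_range_succ _ _
      rw [h t ht, ih, hs]
      ring
  refine Tendsto.congr' ?_ (tendsto_atTop_add_const_right atTop (r k - c * H k)
    (Real.tendsto_sum_range_one_div_nat_succ_atTop.const_mul_atTop hc))
  filter_upwards [eventually_ge_atTop k] with t ht using (hconst t ht).symm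

/-- with the constructed noise, the sequence `(θ̃ t)_{t ≥ k+1}` is
non-increasing and `θ̃ t → -∞`. -/
theorem estimate_error_to_neg_infty
    (y θ r W : ℕ → ℝ) (hr0 : 0 < r 0)
    (hy : ∀ t : ℕ, y (t + 1) = θ t * y t + W (t + 1))
    (hθ : ∀ t : ℕ, θ (t + 1) = θ t - y t * y (t + 1) / r t)
    (hr : ∀ t : ℕ, r (t + 1) = r t + (y (t + 1)) ^ 2)
    (w : ℝ) (hw : 0 < w) (k : ℕ) (hk : 2 ≤ k)
    (hrk : w ^ 2 ≤ r (k - 1))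
    (hθk : |θ (k - 1)| ≤ 1)
    (hyk : |y (k - 1)| ≤ w / (2 * Real.sqrt (k - 1 : ℕ)))
    (hW : ∀ t : ℕ, k ≤ t →
      W t = -θ (t - 1) * y (t - 1) + S (y (t - 1)) * w / (2 * Real.sqrt t)) :
    (∀ s t : ℕ, k + 1 ≤ s → s ≤ t → θ t ≤ θ s) ∧
    Tendsto θ atTop atBot := by
  have hrpos : ∀ t, 0 < r t := by
    intro t
    induction t with
    | zero => exact hr0
    | succ t ih => rw [hr]; positivity
  have hstep : ∀ t, k ≤ t + 1 → y (t + 1) = S (y t) * (w / (2 * √((t + 1 : ℕ) : ℝ))) := by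
    intro t ht
    rw [hy, hW (t + 1) ht, Nat.add_sub_cancel]
    ring
  have hc : ∀ t, 0 < w / (2 * √((t + 1 : ℕ) : ℝ)) := fun t => by positivity
  have hS : ∀ t, k ≤ t + 1 → S (y (t + 1)) = S (y t) := fun t ht => by
    rw [hstep t ht, S_S_mul _ (hc t)]
  have hsq : ∀ t, k ≤ t + 1 → y (t + 1) ^ 2 = w ^ 2 / 4 / (t + 1) := by
    intro t ht
    rw [hstep t ht, mul_pow, sq (S _), S_mul_self, div_pow, mul_pow, Real.sq_sqrt (by positivity)]
    push_cast
    field_simp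
    norm_num
  have hprod : ∀ t, k ≤ t → y (t + 1) ^ 2 ≤ y t * y (t + 1) := by
    intro t ht
    obtain ⟨n, rfl⟩ : ∃ n, t = n + 1 := ⟨t - 1, by omega⟩
    have hle : w / (2 * √((n + 1 + 1 : ℕ) : ℝ)) ≤ w / (2 * √((n + 1 : ℕ) : ℝ)) := by
      gcongr
      omega
    have h1 := hstep (n + 1) (by omega)
    rw [hS n ht] at h1
    rw [h1, hstep n ht]
    have := mul_le_mul_of_nonneg_right hle (hc (n + 1)).le
    calc _ = S (y n) * S (y n) * (w / (2 * √((n + 1 + 1 : ℕ) : ℝ)) * (w / (2 * √((n + 1 + 1 : ℕ) : ℝ)))) := by ring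
      _ ≤ S (y n) * S (y n) * (w / (2 * √((n + 1 : ℕ) : ℝ)) * (w / (2 * √((n + 1 + 1 : ℕ) : ℝ)))) := by
        simpa only [S_mul_self, one_mul] using this
      _ = _ := by ring
  have hanti : ∀ t, k ≤ t → θ (t + 1) ≤ θ t := by
    intro t ht
    rw [hθ]
    have := div_nonneg ((sq_nonneg _).trans (hprod t ht)) (hrpos t).le
    linarith
  have hlog : ∀ t, k ≤ t → θ t ≤ θ k + Real.log (r k) - Real.log (r t) := by
    intro t ht
    induction t, ht using Nat.le_induction with
    | base => simp
    | succ t ht ih =>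
      have h1 := Real.log_le_sub_one_of_pos (div_pos (hrpos (t + 1)) (hrpos t))
      rw [Real.log_div (hrpos _).ne' (hrpos _).ne', hr t, add_div, div_self (hrpos t).ne',
        ← hr t] at h1
      have h2 := div_le_div_of_nonneg_right (hprod t ht) (hrpos t).le
      rw [hθ]
      linarith
  have hrtop : Tendsto r atTop atTop :=
    tendsto_atTop_of_harmonic_increments (c := w ^ 2 / 4) (by positivity)
      fun t (ht : k ≤ t) => by rw [hr, hsq t (by omega)]
  refine ⟨fun s t hs hst => ?_, ?_⟩
  · induction t, hst using Nat.le_induction with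
    | base => exact le_rfl
    | succ t hst ih => exact (hanti t (by omega)).trans ih
  · refine tendsto_atBot_mono' atTop ?_ (tendsto_atBot_add_const_left atTop
      (θ k + Real.log (r k)) (tendsto_neg_atTop_atBot.comp (Real.tendsto_log_atTop.comp hrtop)))
    filter_upwards [eventually_ge_atTop k] with t ht
    simpa [sub_eq_add_neg] using hlog t ht
end

section
/- Let j ≥ 1 be an integer with y_j ≠ 0 and θ̃_j ≠ 0, and suppose w_t = 0 for all t ≥ j+1. Then there exist a constant c_0 > 0, a number α ∈ (0,1), and an integer t_0 ≥ j such that |y_t| ≤ c_0·α^t for all t ≥ t_0, and moreover lim_{t→∞} |θ̃_t| exists and satisfies 0 < lim_{t→∞} |θ̃_t| < 1. -/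
open Filter Finset

section Autonomous

variable {u θ ρ : ℕ → ℝ} {C : ℝ}

/-- If the gains `θ n = C / ρ n` never dropped below one in modulus, the energy `ρ` would grow
linearly, which contradicts `|C| = |θ n| * ρ n ≥ ρ n`. -/
lemma exists_abs_gain_lt_one (hρ : ∀ n, 0 < ρ n) (hu : ∀ n, u (n + 1) = θ n * u n)
    (hρu : ∀ n, ρ (n + 1) = ρ n + u n ^ 2) (hC : ∀ n, θ n * ρ n = C) (hu0 : u 0 ≠ 0) :
    ∃ n, |θ n| < 1 := by
  by_contra! h
  have hmono : ∀ n, u 0 ^ 2 ≤ u n ^ 2 := by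
    intro n
    induction n with
    | zero => exact le_rfl
    | succ n ih =>
      have h1 : 1 ≤ θ n ^ 2 := (one_le_sq_iff_one_le_abs _).2 (h n)
      rw [hu, mul_pow]
      nlinarith [sq_nonneg (u n)]
  have hlin : ∀ n : ℕ, n * u 0 ^ 2 ≤ ρ n := by
    intro n
    induction n with
    | zero => simpa using (hρ 0).le
    | succ n ih =>
      rw [hρu]
      push_cast
      linarith [hmono n]
  obtain ⟨n, hn⟩ := exists_nat_gt (|C| / u 0 ^ 2)
  rw [div_lt_iff₀ (by positivity)] at hn
  have h1 : |θ n| * ρ n = |C| := by rw [← hC n, abs_mul, abs_of_pos (hρ n)]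
  nlinarith [h n, hρ n, hlin n]

lemma abs_gain_eq (hρ : ∀ n, 0 < ρ n) (hC : ∀ n, θ n * ρ n = C) (n : ℕ) :
    |θ n| = |C| / ρ n := by
  rw [eq_div_iff (hρ n).ne', ← hC n, abs_mul, abs_of_pos (hρ n)]

lemma abs_output_le_geometric {n₀ : ℕ} {α : ℝ} (hα : ∀ n, n₀ ≤ n → |θ n| ≤ α)
    (hu : ∀ n, u (n + 1) = θ n * u n) (n : ℕ) : |u (n₀ + n)| ≤ |u n₀| * α ^ n := by
  induction n with
  | zero => simp
  | succ n ih =>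
    have h := hα (n₀ + n) (Nat.le_add_right _ _)
    calc |u (n₀ + (n + 1))| = |θ (n₀ + n)| * |u (n₀ + n)| := by rw [← add_assoc, hu, abs_mul]
      _ ≤ α * (|u n₀| * α ^ n) := mul_le_mul h ih (abs_nonneg _) ((abs_nonneg _).trans h)
      _ = |u n₀| * α ^ (n + 1) := by ring

lemma energy_le {n₀ : ℕ} {α : ℝ} (hα1 : α < 1) (hα : ∀ n, n₀ ≤ n → |θ n| ≤ α)
    (hu : ∀ n, u (n + 1) = θ n * u n) (hρu : ∀ n, ρ (n + 1) = ρ n + u n ^ 2) (n : ℕ) :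
    ρ (n₀ + n) ≤ ρ n₀ + u n₀ ^ 2 / (1 - α ^ 2) := by
  have hα0 : 0 ≤ α := (abs_nonneg _).trans (hα n₀ le_rfl)
  have hpos : 0 < 1 - α ^ 2 := by nlinarith
  have key : ρ (n₀ + n) + u (n₀ + n) ^ 2 / (1 - α ^ 2) ≤ ρ n₀ + u n₀ ^ 2 / (1 - α ^ 2) := by
    induction n with
    | zero => exact le_rfl
    | succ n ih =>
      refine le_trans ?_ ih
      have h : θ (n₀ + n) ^ 2 ≤ α ^ 2 := sq_le_sq' (abs_le.1 (hα _ (Nat.le_add_right _ _))).1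
        (abs_le.1 (hα _ (Nat.le_add_right _ _))).2
      rw [← add_assoc, hρu, hu, add_assoc]
      gcongr
      rw [← le_sub_iff_add_le', ← sub_nonneg]
      have : u (n₀ + n) ^ 2 / (1 - α ^ 2) - u (n₀ + n) ^ 2
          - (θ (n₀ + n) * u (n₀ + n)) ^ 2 / (1 - α ^ 2)
          = u (n₀ + n) ^ 2 * (α ^ 2 - θ (n₀ + n) ^ 2) / (1 - α ^ 2) := by
        field_simp
        ring
      rw [this]
      exact div_nonneg (mul_nonneg (sq_nonneg _) (sub_nonneg.2 h)) hpos.le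
  have : 0 ≤ u (n₀ + n) ^ 2 / (1 - α ^ 2) := by positivity
  linarith

lemma autonomous_decay (hρ : ∀ n, 0 < ρ n) (hu : ∀ n, u (n + 1) = θ n * u n)
    (hρu : ∀ n, ρ (n + 1) = ρ n + u n ^ 2) (hC : ∀ n, θ n * ρ n = C) (hu0 : u 0 ≠ 0)
    (hC0 : C ≠ 0) :
    ∃ c : ℝ, 0 < c ∧ ∃ α ∈ Set.Ioo (0 : ℝ) 1, ∃ n₀, (∀ n, |u (n₀ + n)| ≤ c * α ^ n) ∧
      ∃ L, Tendsto (fun n => |θ n|) atTop (nhds L) ∧ 0 < L ∧ L < 1 := by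
  have hmono : Monotone ρ := monotone_nat_of_le_succ fun n => by
    rw [hρu]
    exact le_add_of_nonneg_right (sq_nonneg _)
  have habs := abs_gain_eq hρ hC
  obtain ⟨n₀, hn₀⟩ := exists_abs_gain_lt_one hρ hu hρu hC hu0
  have hα : ∀ n, n₀ ≤ n → |θ n| ≤ |θ n₀| := fun n hn => by
    rw [habs, habs]
    exact div_le_div_of_nonneg_left (abs_nonneg _) (hρ _) (hmono hn)
  have hθ0 : 0 < |θ n₀| := by
    rw [habs]
    exact div_pos (abs_pos.2 hC0) (hρ _)
  have hbdd : BddAbove (Set.range ρ) := by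
    refine ⟨ρ n₀ + u n₀ ^ 2 / (1 - |θ n₀| ^ 2), ?_⟩
    rintro _ ⟨n, rfl⟩
    exact (hmono (Nat.le_add_left n n₀)).trans (energy_le hn₀ hα hu hρu n)
  have hR : 0 < ⨆ n, ρ n := (hρ n₀).trans_le (le_ciSup hbdd n₀)
  refine ⟨|u n₀| + 1, by positivity, |θ n₀|, ⟨hθ0, hn₀⟩, n₀, fun n => ?_,
    |C| / ⨆ n, ρ n, ?_, div_pos (abs_pos.2 hC0) hR, ?_⟩
  · refine (abs_output_le_geometric hα hu n).trans ?_
    gcongr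
    linarith
  · simp_rw [habs]
    exact tendsto_const_nhds.div (tendsto_atTop_ciSup hmono hbdd) hR.ne'
  · refine lt_of_le_of_lt ?_ hn₀
    rw [habs]
    exact div_le_div_of_nonneg_left (abs_nonneg _) (hρ _) (le_ciSup hbdd n₀)

end Autonomous

/-- Lemma 3(i): if the noise vanishes after time `j` and
`y j ≠ 0`, `θ̃ j ≠ 0`, then the outputs decay geometrically and `|θ̃ t|`
converges to a limit in `(0, 1)`. -/
theorem noise_free_decay
    (y θ r W : ℕ → ℝ) (hr0 : 0 < r 0)
    (hy : ∀ t : ℕ, y (t + 1) = θ t * y t + W (t + 1))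
    (hθ : ∀ t : ℕ, θ (t + 1) = θ t - y t * y (t + 1) / r t)
    (hr : ∀ t : ℕ, r (t + 1) = r t + (y (t + 1)) ^ 2)
    (j : ℕ) (hj : 1 ≤ j) (hyj : y j ≠ 0) (hθj : θ j ≠ 0)
    (hW : ∀ t : ℕ, j + 1 ≤ t → W t = 0) :
    ∃ c₀ : ℝ, 0 < c₀ ∧ ∃ α : ℝ, α ∈ Set.Ioo (0 : ℝ) 1 ∧ ∃ t₀ : ℕ, j ≤ t₀ ∧
      (∀ t : ℕ, t₀ ≤ t → |y t| ≤ c₀ * α ^ t) ∧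
      ∃ L : ℝ, Tendsto (fun t : ℕ => |θ t|) atTop (nhds L) ∧ 0 < L ∧ L < 1 := by
  obtain ⟨k, rfl⟩ : ∃ k, j = k + 1 := ⟨j - 1, by omega⟩
  have hrpos : ∀ t, 0 < r t := by
    intro t
    induction t with
    | zero => exact hr0
    | succ t ih =>
      rw [hr]
      positivity
  have hu : ∀ n, y (k + 1 + (n + 1)) = θ (k + 1 + n) * y (k + 1 + n) := fun n => by
    rw [← add_assoc, hy, hW _ (by omega), add_zero]
  have hρu : ∀ n, r (k + (n + 1)) = r (k + n) + y (k + 1 + n) ^ 2 := fun n => by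
    rw [← add_assoc, hr, add_right_comm]
  have hC : ∀ n, θ (k + 1 + n) * r (k + n) = θ (k + 1) * r k := by
    intro n
    induction n with
    | zero => rfl
    | succ n ih =>
      have hne := (hrpos (k + 1 + n)).ne'
      have h1 : r (k + 1 + n) = r (k + n) + y (k + 1 + n) ^ 2 := by
        rw [← hρu, add_assoc, add_comm 1 n]
      rw [← ih, show k + (n + 1) = k + 1 + n by omega, ← add_assoc, hθ, add_assoc (k + 1), hu]
      field_simp
      rw [h1]
      ring
  obtain ⟨c, hc, α, hα, n₀, hdecay, L, hL, hL0, hL1⟩ :=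
    autonomous_decay (u := fun n => y (k + 1 + n)) (θ := fun n => θ (k + 1 + n))
      (ρ := fun n => r (k + n)) (fun n => hrpos _) hu hρu hC hyj
      (mul_ne_zero hθj (hrpos k).ne')
  have hα0 : 0 < α := hα.1
  refine ⟨c / α ^ (k + 1 + n₀), by positivity, α, hα, k + 1 + n₀, Nat.le_add_right _ _, ?_,
    L, ?_, hL0, hL1⟩
  · intro t ht
    obtain ⟨n, rfl⟩ := Nat.exists_eq_add_of_le ht
    have h : c / α ^ (k + 1 + n₀) * α ^ (k + 1 + n₀ + n) = c * α ^ n := by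
      rw [pow_add α (k + 1 + n₀) n]
      field_simp
    rw [h, add_assoc (k + 1)]
    exact hdecay n
  · rw [← tendsto_add_atTop_iff_nat (k + 1)]
    simpa only [add_comm] using hL
end

section
/- Let j ≥ 1 be an integer with y_j ≠ 0 and θ̃_j ≠ 0, suppose w_t = 0 for all t ≥ j+1, and suppose |θ̃_j| ≥ 6. Then there exists an integer l ≥ j such that r_{l−1} ≤ 3·r_{j−1} and y_l² ≥ r_{j−1}. -/
open Filter Finset

/-- Lemma 3(ii): if the noise vanishes after time `j`, `y j ≠ 0`,
`θ̃ j ≠ 0` and `|θ̃ j| ≥ 6`, then there is `l ≥ j` with `r (l-1) ≤ 3 r (j-1)` and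
`y l ^ 2 ≥ r (j-1)`. -/
theorem burst_time_exists
    (y θ r W : ℕ → ℝ) (hr0 : 0 < r 0)
    (hy : ∀ t : ℕ, y (t + 1) = θ t * y t + W (t + 1))
    (hθ : ∀ t : ℕ, θ (t + 1) = θ t - y t * y (t + 1) / r t)
    (hr : ∀ t : ℕ, r (t + 1) = r t + (y (t + 1)) ^ 2)
    (j : ℕ) (hj : 1 ≤ j) (hyj : y j ≠ 0) (hθj : θ j ≠ 0)
    (hθj6 : 6 ≤ |θ j|)
    (hW : ∀ t : ℕ, j + 1 ≤ t → W t = 0) :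
    ∃ l : ℕ, j ≤ l ∧ r (l - 1) ≤ 3 * r (j - 1) ∧ r (j - 1) ≤ (y l) ^ 2 := by
  obtain ⟨k, rfl⟩ : ∃ k, j = k + 1 := ⟨j - 1, by omega⟩
  have hpos : ∀ t, 0 < r t := by
    intro t
    induction t with
    | zero => exact hr0
    | succ t ih => rw [hr]; positivity
  have hR := hpos k
  simp only [Nat.add_sub_cancel]
  by_contra! hcon
  have hbound : ∀ n, r (k + n) ≤ 3 * r k → y (k + n + 1) ^ 2 < r k := fun n h =>
    hcon (k + n + 1) (by omega) (by simpa using h)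
  have hinv : ∀ n, 4 ^ n * y (k + 1) ^ 2 ≤ y (k + n + 1) ^ 2 ∧
      r (k + n + 1) ≤ r k + 4 / 3 * y (k + n + 1) ^ 2 ∧ r (k + n) ≤ 3 * r k ∧
      θ (k + n + 1) * r (k + n) = θ (k + 1) * r k := by
    intro n
    induction n with
    | zero =>
      refine ⟨by simp, ?_, ?_, rfl⟩
      · rw [Nat.add_zero, hr]
        nlinarith [sq_nonneg (y (k + 1))]
      · rw [Nat.add_zero]
        linarith
    | succ n ih =>
      obtain ⟨hgrow, hsum, hle, hconst⟩ := ih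
      have hlt := hbound n hle
      have hynext : y (k + n + 1 + 1) = θ (k + n + 1) * y (k + n + 1) := by
        rw [hy, hW _ (by omega), add_zero]
      have hθsq : 4 ≤ θ (k + n + 1) ^ 2 := by
        have habs : |θ (k + n + 1)| * r (k + n) = |θ (k + 1)| * r k := by
          simpa [abs_mul, abs_of_pos, hpos] using congrArg abs hconst
        have h2 : 2 ≤ |θ (k + n + 1)| := by
          by_contra! h
          nlinarith [hpos (k + n)]
        rw [← sq_abs]
        nlinarith
      have hquad : 4 * y (k + n + 1) ^ 2 ≤ y (k + n + 1 + 1) ^ 2 := by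
        rw [hynext, mul_pow]
        exact mul_le_mul_of_nonneg_right hθsq (sq_nonneg _)
      rw [← add_assoc k n 1]
      refine ⟨?_, ?_, by linarith, ?_⟩
      · rw [pow_succ]
        linarith
      · rw [hr (k + n + 1)]
        linarith
      · have hne := (hpos (k + n + 1)).ne'
        rw [hθ, hynext, ← hconst, sub_mul, div_mul_cancel₀ _ hne, hr (k + n)]
        ring
  have hy2 : 0 < y (k + 1) ^ 2 := by positivity
  obtain ⟨n, hn⟩ := pow_unbounded_of_one_lt (r k / y (k + 1) ^ 2) (by norm_num : (1 : ℝ) < 4)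
  rw [div_lt_iff₀ hy2] at hn
  obtain ⟨hgrow, -, hle, -⟩ := hinv n
  linarith [hbound n hle]
end

section
/- Let j ≥ 1 be an integer with y_j ≠ 0, |θ̃_j| ≥ 6, and suppose w_t = 0 for all t ≥ j+1. Let l ≥ j be an integer with r_{l−1} ≤ 3·r_{j−1} and y_l² ≥ r_{j−1}. Then |θ̃_l|² ≥ (1/9)·θ̃_j² and y_{l+1}² + y_{l+2}² ≥ (1/18)·r_{j−1}·|θ̃_j|³. -/
open Filter Finset

/-- Without noise the closed loop conserves `θ (t + 1) * r t`. -/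
theorem theta_mul_r_step {y θ r : ℕ → ℝ} {t : ℕ} (hrt : r (t + 1) ≠ 0)
    (hy : y (t + 2) = θ (t + 1) * y (t + 1))
    (hθ : θ (t + 2) = θ (t + 1) - y (t + 1) * y (t + 2) / r (t + 1))
    (hr : r (t + 1) = r t + (y (t + 1)) ^ 2) :
    θ (t + 2) * r (t + 1) = θ (t + 1) * r t := by
  rw [hθ, sub_mul, div_mul_cancel₀ _ hrt, hy, hr]
  ring

/-- if the noise vanishes after time `j`, `y j ≠ 0`, `|θ̃ j| ≥ 6`, and
`l ≥ j` satisfies `r (l-1) ≤ 3 r (j-1)` and `y l ^ 2 ≥ r (j-1)`, then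
`θ̃ l ^ 2 ≥ (1/9) θ̃ j ^ 2` and `y (l+1) ^ 2 + y (l+2) ^ 2 ≥ (1/18) r (j-1) |θ̃ j| ^ 3`. -/
theorem burst_energy
    (y θ r W : ℕ → ℝ) (hr0 : 0 < r 0)
    (hy : ∀ t : ℕ, y (t + 1) = θ t * y t + W (t + 1))
    (hθ : ∀ t : ℕ, θ (t + 1) = θ t - y t * y (t + 1) / r t)
    (hr : ∀ t : ℕ, r (t + 1) = r t + (y (t + 1)) ^ 2)
    (j : ℕ) (hj : 1 ≤ j) (hyj : y j ≠ 0) (hθj : 6 ≤ |θ j|)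
    (hW : ∀ t : ℕ, j + 1 ≤ t → W t = 0)
    (l : ℕ) (hl : j ≤ l)
    (hrl : r (l - 1) ≤ 3 * r (j - 1))
    (hyl : r (j - 1) ≤ (y l) ^ 2) :
    (1 / 9) * (θ j) ^ 2 ≤ (θ l) ^ 2 ∧
    (1 / 18) * r (j - 1) * |θ j| ^ 3 ≤ (y (l + 1)) ^ 2 + (y (l + 2)) ^ 2 := by
  obtain ⟨i, rfl⟩ : ∃ i, j = i + 1 := ⟨j - 1, by omega⟩
  obtain ⟨m, rfl⟩ : ∃ m, l = m + 1 := ⟨l - 1, by omega⟩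
  simp only [Nat.add_sub_cancel] at hrl hyl ⊢
  have hpos : ∀ t, 0 < r t := by
    intro t
    induction t with
    | zero => exact hr0
    | succ t ih => rw [hr]; positivity
  have hy' : ∀ t, i ≤ t → y (t + 2) = θ (t + 1) * y (t + 1) := fun t ht => by
    rw [hy (t + 1), hW _ (by omega), add_zero]
  have hstep : ∀ t, i ≤ t → θ (t + 2) * r (t + 1) = θ (t + 1) * r t := fun t ht =>
    theta_mul_r_step (hpos _).ne' (hy' t ht) (hθ (t + 1)) (hr t)
  have hinv : ∀ t, i ≤ t → θ (t + 1) * r t = θ (i + 1) * r i := by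
    intro t ht
    induction t, ht using Nat.le_induction with
    | base => rfl
    | succ t ht ih => rw [hstep t ht, ih]
  have him : i ≤ m := by omega
  have hRi := hpos i
  have habs : ∀ t, i ≤ t → |θ (t + 1)| * r t = |θ (i + 1)| * r i := fun t ht => by
    rw [← abs_of_pos (hpos t), ← abs_mul, hinv t ht, abs_mul, abs_of_pos hRi]
  have hb : |θ (i + 1)| ≤ 3 * |θ (m + 1)| := by
    refine le_of_mul_le_mul_right ?_ hRi
    rw [← habs m him]
    nlinarith [mul_le_mul_of_nonneg_left hrl (abs_nonneg (θ (m + 1)))]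
  have hsq : (1 / 9) * (θ (i + 1)) ^ 2 ≤ (θ (m + 1)) ^ 2 := by
    rw [← sq_abs (θ (i + 1)), ← sq_abs (θ (m + 1))]
    nlinarith [pow_le_pow_left₀ (abs_nonneg (θ (i + 1))) hb 2]
  refine ⟨hsq, ?_⟩
  have hcY : |θ (i + 1)| * r i ≤ 4 * (|θ (m + 2)| * (y (m + 1)) ^ 2) := by
    rw [← habs (m + 1) (by omega), hr m]
    have h : r m + (y (m + 1)) ^ 2 ≤ 4 * (y (m + 1)) ^ 2 := by linarith
    linarith [mul_le_mul_of_nonneg_left h (abs_nonneg (θ (m + 2)))]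
  have hy2 : y (m + 1 + 2) = θ (m + 2) * y (m + 2) := hy' (m + 1) (by omega)
  calc (1 / 18) * r i * |θ (i + 1)| ^ 3
      = 2 * ((1 / 9) * (θ (i + 1)) ^ 2) * ((1 / 4) * (|θ (i + 1)| * r i)) := by
        rw [← sq_abs (θ (i + 1))]; ring
    _ ≤ 2 * (θ (m + 1)) ^ 2 * (|θ (m + 2)| * (y (m + 1)) ^ 2) := by
        gcongr 2 * ?_ * ?_
        linarith
    _ = (2 * |θ (m + 2)|) * (y (m + 2)) ^ 2 := by rw [hy' m him]; ring
    _ ≤ (1 + (θ (m + 2)) ^ 2) * (y (m + 2)) ^ 2 := by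
        gcongr
        rw [← sq_abs (θ (m + 2))]
        linarith [sq_nonneg (1 - |θ (m + 2)|)]
    _ = (y (m + 1 + 1)) ^ 2 + (y (m + 1 + 2)) ^ 2 := by rw [hy2]; ring
end

section
/- Let w > 0 and suppose the noise sequence is given by w_1 = S(θ̃_0·y_0)·w and w_t = 0 for all t ≥ 2. Then there exists an integer k ≥ 3 such that r_{k−1} ≥ w², |θ̃_{k−1}| ≤ 1, and |y_{k−1}| ≤ w/(2√(k−1)). -/
open Filter Finset

/-- Adding a perturbation with the sign of `x` makes the absolute value at least its size. -/
theorem le_abs_add_sign_mul (x w : ℝ) : w ≤ |x + S x * w| := by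
  unfold S
  split_ifs with hx
  · exact le_abs.mpr (Or.inr (by linarith))
  · exact le_abs.mpr (Or.inl (by linarith))

/-- Geometric decay beats linear growth. -/
theorem exists_add_mul_pow_mul_le (m : ℕ) {q : ℝ} (hq0 : 0 ≤ q) (hq1 : q < 1) (c : ℝ)
    {ε : ℝ} (hε : 0 < ε) : ∃ n : ℕ, ((m + n : ℕ) : ℝ) * q ^ n * c ≤ ε := by
  have h := (((tendsto_pow_atTop_nhds_zero_of_lt_one hq0 hq1).const_mul (m : ℝ)).add
    (tendsto_self_mul_const_pow_of_lt_one hq0 hq1)).mul_const c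
  rw [mul_zero, zero_add, zero_mul] at h
  obtain ⟨n, hn⟩ := (h.eventually_le_const hε).exists
  refine ⟨n, le_of_eq_of_le ?_ hn⟩
  push_cast
  ring

/-- with the noise `w 1 = S(θ̃ 0 · y 0) · w` and `w t = 0` for `t ≥ 2`,
there exists `k ≥ 3` with `r (k-1) ≥ w²`, `|θ̃ (k-1)| ≤ 1` and
`|y (k-1)| ≤ w / (2√(k-1))`. -/
theorem initialization_time_exists
    (y θ r W : ℕ → ℝ) (hr0 : 0 < r 0)
    (hy : ∀ t : ℕ, y (t + 1) = θ t * y t + W (t + 1))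
    (hθ : ∀ t : ℕ, θ (t + 1) = θ t - y t * y (t + 1) / r t)
    (hr : ∀ t : ℕ, r (t + 1) = r t + (y (t + 1)) ^ 2)
    (w : ℝ) (hw : 0 < w)
    (hW1 : W 1 = S (θ 0 * y 0) * w)
    (hW2 : ∀ t : ℕ, 2 ≤ t → W t = 0) :
    ∃ k : ℕ, 3 ≤ k ∧ w ^ 2 ≤ r (k - 1) ∧ |θ (k - 1)| ≤ 1 ∧
      |y (k - 1)| ≤ w / (2 * Real.sqrt (k - 1 : ℕ)) := by
  have hrec : ∀ t, 1 ≤ t → y (t + 1) = θ t * y t := fun t ht => by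
    rw [hy, hW2 (t + 1) (by omega), add_zero]
  have hrpos : ∀ t, 0 < r t := fun t => by
    induction t with
    | zero => exact hr0
    | succ t ih => rw [hr]; positivity
  have hinv : ∀ t, θ (t + 1) * r t = θ 1 * r 0 := fun t => by
    induction t with
    | zero => rfl
    | succ t ih =>
      rw [← ih, hθ (t + 1), hrec (t + 1) (by omega)]
      have hne := (hrpos (t + 1)).ne'
      field_simp
      rw [hr t]
      ring
  have hrmono : Monotone r := monotone_nat_of_le_succ fun t => by
    rw [hr]; nlinarith [sq_nonneg (y (t + 1))]
  have hθanti : ∀ s t, s ≤ t → |θ (t + 1)| ≤ |θ (s + 1)| := fun s t hst => by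
    have h := congrArg abs ((hinv t).trans (hinv s).symm)
    rw [abs_mul, abs_mul, abs_of_pos (hrpos t), abs_of_pos (hrpos s)] at h
    have hle := mul_le_mul_of_nonneg_left (hrmono hst) (abs_nonneg (θ (t + 1)))
    exact le_of_mul_le_mul_right (hle.trans h.le) (hrpos s)
  have hy1 : w ≤ |y 1| := by
    rw [hy 0, zero_add, hW1]
    exact le_abs_add_sign_mul _ _
  have hr1 : w ^ 2 ≤ r 1 := by
    rw [hr 0, zero_add, ← sq_abs (y 1)]
    nlinarith [pow_le_pow_left₀ hw.le hy1 2]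
  have hsmall : ∃ T, |θ (T + 2)| < 1 := by
    by_contra! hbig
    have hge : ∀ t, 1 ≤ |θ (t + 1)| := fun t =>
      (hbig t).trans (hθanti t (t + 1) (by omega))
    have hyge : ∀ t, w ≤ |y (t + 1)| := fun t => by
      induction t with
      | zero => exact hy1
      | succ t ih =>
        rw [hrec (t + 1) (by omega), abs_mul]
        nlinarith [hge t, abs_nonneg (y (t + 1))]
    have hrge : ∀ t : ℕ, t * w ^ 2 ≤ r t := fun t => by
      induction t with
      | zero => simpa using hr0.le
      | succ t ih =>
        rw [hr, ← sq_abs (y (t + 1))]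
        push_cast
        nlinarith [pow_le_pow_left₀ hw.le (hyge t) 2]
    obtain ⟨n, hn⟩ := exists_nat_gt (|θ 1 * r 0| / w ^ 2)
    rw [div_lt_iff₀ (by positivity)] at hn
    have h := congrArg abs (hinv n)
    rw [abs_mul, abs_of_pos (hrpos n)] at h
    nlinarith [hge n, hrge n, hrpos n]
  obtain ⟨T, hT⟩ := hsmall
  have hθle : ∀ n, |θ (T + 2 + n)| ≤ |θ (T + 2)| := fun n => by
    have h := hθanti (T + 1) (T + 1 + n) (by omega)
    rwa [show T + 1 + n + 1 = T + 2 + n by omega] at h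
  have hdecay : ∀ n, |y (T + 2 + n)| ≤ |θ (T + 2)| ^ n * |y (T + 2)| := fun n => by
    induction n with
    | zero => simp
    | succ n ih =>
      rw [← add_assoc, hrec (T + 2 + n) (by omega), abs_mul, pow_succ', mul_assoc]
      exact mul_le_mul (hθle n) ih (abs_nonneg _) (abs_nonneg _)
  obtain ⟨n, hn⟩ := exists_add_mul_pow_mul_le (T + 2) (abs_nonneg (θ (T + 2))) hT
    (2 * |y (T + 2)|) hw
  refine ⟨T + 2 + n + 1, by omega, ?_, ?_, ?_⟩
  · exact hr1.trans (hrmono (by omega))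
  · exact (hθle n).trans hT.le
  · rw [Nat.add_sub_cancel]
    have hcast : (1 : ℝ) ≤ ((T + 2 + n : ℕ) : ℝ) := by exact_mod_cast (by omega : 1 ≤ T + 2 + n)
    have hsqrt : √((T + 2 + n : ℕ) : ℝ) ≤ ((T + 2 + n : ℕ) : ℝ) :=
      Real.sqrt_le_self_iff.mpr (Or.inr hcast)
    have hsqrtpos : 0 < √((T + 2 + n : ℕ) : ℝ) := Real.sqrt_pos.mpr (by linarith)
    rw [le_div_iff₀ (by positivity)]
    calc |y (T + 2 + n)| * (2 * √((T + 2 + n : ℕ) : ℝ))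
        ≤ (|θ (T + 2)| ^ n * |y (T + 2)|) * (2 * ((T + 2 + n : ℕ) : ℝ)) := by
          gcongr
          exact hdecay n
      _ = ((T + 2 + n : ℕ) : ℝ) * |θ (T + 2)| ^ n * (2 * |y (T + 2)|) := by ring
      _ ≤ w := hn
end

section
/- Let w > 0 and let k ≥ 2 be an integer such that r_{k−1} ≥ w², |θ̃_{k−1}| ≤ 1, and |y_{k−1}| ≤ w/(2√(k−1)). For every constant c > 0, if w_t = −θ̃_{t−1}·y_{t−1} + S(y_{t−1})·w/(2√t) for all t ≥ k, then there exists an integer j ≥ k such that |θ̃_j| ≥ max{|θ̃_0|, |θ̃_1|, …, |θ̃_{j−1}|, 6, 126c}. -/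
open Filter Finset

/-- A sequence tending to `-∞` and bounded above from time `k` on by its value at `k` attains,
at some time `j ≥ k`, an absolute value that is at least `B` and dominates all earlier ones. -/
lemma exists_abs_dominating {θ : ℕ → ℝ} {k : ℕ} (hle : ∀ t, k ≤ t → θ t ≤ θ k)
    (hbot : Tendsto θ atTop atBot) (B : ℝ) :
    ∃ j : ℕ, k ≤ j ∧ (∀ i : ℕ, i < j → |θ i| ≤ |θ j|) ∧ B ≤ |θ j| := by
  classical
  obtain ⟨A, hA⟩ := ((Finset.range (k + 1)).image fun i => |θ i|).bddAbove
  have hA' : ∀ i, i ≤ k → |θ i| ≤ A := fun i hi =>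
    hA (by simpa using ⟨i, hi, rfl⟩)
  have hex : ∃ j, k ≤ j ∧ θ j ≤ -(max A B) :=
    ((eventually_ge_atTop k).and (hbot.eventually_le_atBot _)).exists
  obtain ⟨hkj, hj⟩ := Nat.find_spec hex
  have habs : max A B ≤ |θ (Nat.find hex)| := by
    linarith [neg_abs_le (θ (Nat.find hex))]
  refine ⟨Nat.find hex, hkj, fun i hi => ?_, (le_max_right _ _).trans habs⟩
  refine le_trans ?_ habs
  rcases le_total i k with hik | hik
  · exact (hA' i hik).trans (le_max_left _ _)
  · have hmin := Nat.find_min hex hi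
    rw [not_and, not_le] at hmin
    exact abs_le.2 ⟨(hmin hik).le, (hle i hik).trans
      ((le_abs_self _).trans ((hA' k le_rfl).trans (le_max_left _ _)))⟩

lemma S_eq_one_or (x : ℝ) : S x = 1 ∨ S x = -1 := by
  unfold S; split_ifs <;> simp

lemma S_mul_of_pos (x : ℝ) {a : ℝ} (ha : 0 < a) : S (S x * a) = S x := by
  unfold S
  split_ifs <;> first | rfl | nlinarith

/-- A sequence whose increments from time `k` on are `b / (t + 1)` with `b > 0` diverges. -/
lemma tendsto_atTop_of_harmonic_increments_s17 {r : ℕ → ℝ} {k : ℕ} {b : ℝ} (hb : 0 < b)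
    (hr : ∀ t, k ≤ t → r (t + 1) = r t + b * (1 / ((t : ℝ) + 1))) :
    Tendsto r atTop atTop := by
  have heq : ∀ t, k ≤ t → r t = b * ∑ i ∈ Finset.range t, (1 / ((i : ℝ) + 1)) +
      (r k - b * ∑ i ∈ Finset.range k, (1 / ((i : ℝ) + 1))) := by
    intro t ht
    induction t, ht using Nat.le_induction with
    | base => ring
    | succ t ht ih => rw [hr t ht, Finset.sum_range_succ, ih]; ring
  refine Tendsto.congr' ?_ (tendsto_atTop_add_const_right _
    (r k - b * ∑ i ∈ Finset.range k, (1 / ((i : ℝ) + 1)))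
    (Real.tendsto_sum_range_one_div_nat_succ_atTop.const_mul_atTop hb))
  filter_upwards [eventually_ge_atTop k] with t ht using (heq t ht).symm

/-- with the constructed noise applied from time `k` on, for every `c > 0`
there exists `j ≥ k` with `|θ̃ j| ≥ max{|θ̃ 0|, …, |θ̃ (j-1)|, 6, 126 c}`. -/
theorem dominating_time_exists
    (y θ r W : ℕ → ℝ) (hr0 : 0 < r 0)
    (hy : ∀ t : ℕ, y (t + 1) = θ t * y t + W (t + 1))
    (hθ : ∀ t : ℕ, θ (t + 1) = θ t - y t * y (t + 1) / r t)
    (hr : ∀ t : ℕ, r (t + 1) = r t + (y (t + 1)) ^ 2)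
    (w : ℝ) (hw : 0 < w) (k : ℕ) (hk : 2 ≤ k)
    (hrk : w ^ 2 ≤ r (k - 1))
    (hθk : |θ (k - 1)| ≤ 1)
    (hyk : |y (k - 1)| ≤ w / (2 * Real.sqrt (k - 1 : ℕ)))
    (c : ℝ) (hc : 0 < c)
    (hW : ∀ t : ℕ, k ≤ t →
      W t = -θ (t - 1) * y (t - 1) + S (y (t - 1)) * w / (2 * Real.sqrt t)) :
    ∃ j : ℕ, k ≤ j ∧ (∀ i : ℕ, i < j → |θ i| ≤ |θ j|) ∧
      6 ≤ |θ j| ∧ 126 * c ≤ |θ j| := by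
  have hrpos : ∀ t, 0 < r t := by
    intro t
    induction t with
    | zero => exact hr0
    | succ t ih => rw [hr]; positivity
  have hstep : ∀ t, k ≤ t + 1 →
      y (t + 1) = S (y t) * (w / (2 * Real.sqrt (t + 1 : ℕ))) := by
    intro t ht
    rw [hy, hW (t + 1) ht, Nat.add_sub_cancel]
    ring
  have hyt : ∀ t, k ≤ t → y t = S (y (k - 1)) * (w / (2 * Real.sqrt t)) := by
    intro t ht
    induction t, ht using Nat.le_induction with
    | base =>
      have h := hstep (k - 1) (by omega)
      rwa [Nat.sub_add_cancel (by omega : 1 ≤ k)] at h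
    | succ t ht ih =>
      have htpos : (0 : ℝ) < t := by exact_mod_cast (by omega : 0 < t)
      have hS : S (y t) = S (y (k - 1)) := by
        rw [ih]; exact S_mul_of_pos _ (by positivity)
      rw [hstep t (by omega), hS]
  have hsq : S (y (k - 1)) * S (y (k - 1)) = 1 := by
    rcases S_eq_one_or (y (k - 1)) with h | h <;> rw [h] <;> norm_num
  have hysq : ∀ t, k ≤ t → y (t + 1) ^ 2 = w ^ 2 / 4 * (1 / ((t : ℝ) + 1)) := by
    intro t ht
    have h := Real.sq_sqrt (Nat.cast_nonneg (α := ℝ) (t + 1))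
    rw [hyt (t + 1) (by omega), mul_pow, pow_two (S _), hsq, div_pow, mul_pow, h]
    push_cast
    field_simp
    norm_num
  have hmul : ∀ t, k ≤ t → y (t + 1) ^ 2 ≤ y t * y (t + 1) := by
    intro t ht
    have htpos : (0 : ℝ) < t := by exact_mod_cast (by omega : 0 < t)
    have hle : w / (2 * Real.sqrt (t + 1 : ℕ)) ≤ w / (2 * Real.sqrt t) := by
      gcongr
      exact Nat.le_succ t
    have hnn : 0 ≤ w / (2 * Real.sqrt (t + 1 : ℕ)) := by positivity
    rw [hyt t ht, hyt (t + 1) (by omega), mul_mul_mul_comm, hsq, mul_pow, pow_two (S _), hsq,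
      pow_two]
    nlinarith
  have hrtop : Tendsto r atTop atTop :=
    tendsto_atTop_of_harmonic_increments_s17 (k := k) (b := w ^ 2 / 4) (by positivity)
      fun t ht => by rw [hr, hysq t ht]
  have hlog : ∀ t, k ≤ t →
      θ (t + 1) + Real.log (r (t + 1)) ≤ θ t + Real.log (r t) := by
    intro t ht
    have h1 := Real.log_le_sub_one_of_pos (div_pos (hrpos (t + 1)) (hrpos t))
    rw [Real.log_div (hrpos _).ne' (hrpos _).ne', hr t, add_div, div_self (hrpos t).ne'] at h1
    have h2 := div_le_div_of_nonneg_right (hmul t ht) (hrpos t).le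
    rw [hθ, hr t]
    linarith
  have hpot : ∀ t, k ≤ t → θ t + Real.log (r t) ≤ θ k + Real.log (r k) := by
    intro t ht
    induction t, ht using Nat.le_induction with
    | base => exact le_rfl
    | succ t ht ih => exact (hlog t ht).trans ih
  have hrmono : Monotone r := monotone_nat_of_le_succ fun t => by
    rw [hr]; exact le_add_of_nonneg_right (sq_nonneg _)
  have hle : ∀ t, k ≤ t → θ t ≤ θ k := fun t ht => by
    linarith [hpot t ht, Real.log_le_log (hrpos k) (hrmono ht)]
  have hbot : Tendsto θ atTop atBot := by
    refine tendsto_atBot_mono' atTop ?_ (tendsto_atBot_add_const_left _ (θ k + Real.log (r k))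
      (tendsto_neg_atTop_atBot.comp (Real.tendsto_log_atTop.comp hrtop)))
    filter_upwards [eventually_ge_atTop k] with t ht
    have := hpot t ht
    simp only [Function.comp_apply]
    linarith
  obtain ⟨j, hkj, hdom, hB⟩ := exists_abs_dominating hle hbot (max 6 (126 * c))
  exact ⟨j, hkj, hdom, (le_max_left _ _).trans hB, (le_max_right _ _).trans hB⟩
end
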